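/- arXiv:2507.21022 — 6 statements merged into one kernel-verified Lean document; each statement's English description precedes it below -/
import Mathlib

section
/- Let 𝒳 be a nonempty finite set with |𝒳| = k + 1, Θ ⊆ ℝ^k open, and θ ↦ p_θ a continuously differentiable family of strictly positive probability distributions on 𝒳 such that at a given θ ∈ Θ the vectors ∂p_θ/∂θ_1, …, ∂p_θ/∂θ_k (viewed as functions 𝒳 → ℝ) are linearly independent, so that the α-Fisher information matrix G^{(α)}(θ) is invertible. Then for every A : 𝒳 → ℝ, writing E(θ) := ∑_{x∈𝒳} A(x) p_θ(x), one has V_α[A] = (1 / ∑_{y∈𝒳} p_θ(y)^{1−α}) · ∑_{i,j=1}^k (G^{(α)}(θ)^{−1})_{ij} · ∂E/∂θ_i(θ) · ∂E/∂θ_j(θ), where V_α[A] is the variance of A under the escort distribution of p_θ. -/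
/-- In a space of functions on a finite set with `k + 1` points, `k` linearly independent functions
with zero sum span all functions with zero sum. -/
theorem mem_span_range_of_sum_eq_zero {X : Type*} [Fintype X] [Nonempty X] {k : ℕ}
    (hcard : Fintype.card X = k + 1) {D : Fin k → X → ℝ} (hli : LinearIndependent ℝ D)
    (hD : ∀ i, ∑ x, D i x = 0) {B : X → ℝ} (hB : ∑ x, B x = 0) :
    B ∈ Submodule.span ℝ (Set.range D) := by
  let H : Submodule ℝ (X → ℝ) := LinearMap.ker (∑ x : X, LinearMap.proj (R := ℝ) (φ := fun _ => ℝ) x)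
  have mem_H (f : X → ℝ) : f ∈ H ↔ ∑ x, f x = 0 := by simp [H, LinearMap.sum_apply]
  have hle : Submodule.span ℝ (Set.range D) ≤ H := by
    rw [Submodule.span_le]
    rintro _ ⟨i, rfl⟩
    exact (mem_H _).2 (hD i)
  have hne : H ≠ ⊤ := by
    intro h
    have h1 : (fun _ : X => (1 : ℝ)) ∈ H := h ▸ Submodule.mem_top
    rw [mem_H] at h1
    simp at h1
  have hlt : Module.finrank ℝ H < k + 1 := by
    simpa [hcard] using Submodule.finrank_lt hne
  have hspan : Module.finrank ℝ (Submodule.span ℝ (Set.range D)) = k := by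
    simpa using finrank_span_eq_card hli
  rw [Submodule.eq_of_le_of_finrank_le hle (by omega)]
  exact (mem_H B).2 hB

/-- Applying a weighted Gram matrix to a vector of coefficients. -/
theorem weightedGram_mulVec {X ι : Type*} [Fintype X] [Fintype ι] {D : ι → X → ℝ} {u : X → ℝ}
    {G : Matrix ι ι ℝ} (hG : ∀ i j, G i j = ∑ x, u x * D i x * D j x) (c : ι → ℝ) (i : ι) :
    (G.mulVec c) i = ∑ x, u x * D i x * ∑ j, c j * D j x := by
  simp only [Matrix.mulVec, dotProduct, hG, Finset.sum_mul, Finset.mul_sum]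
  rw [Finset.sum_comm]
  refine Finset.sum_congr rfl fun x _ => Finset.sum_congr rfl fun j _ => ?_
  ring

/-- The quadratic form of a weighted Gram matrix is a weighted sum of squares. -/
theorem dotProduct_weightedGram_mulVec {X ι : Type*} [Fintype X] [Fintype ι] {D : ι → X → ℝ}
    {u : X → ℝ} {G : Matrix ι ι ℝ} (hG : ∀ i j, G i j = ∑ x, u x * D i x * D j x) (c : ι → ℝ) :
    c ⬝ᵥ G.mulVec c = ∑ x, u x * (∑ j, c j * D j x) ^ 2 := by
  simp only [dotProduct, weightedGram_mulVec hG, Finset.mul_sum (s := (Finset.univ : Finset X))]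
  rw [Finset.sum_comm]
  refine Finset.sum_congr rfl fun x _ => ?_
  rw [sq, ← mul_assoc, mul_comm (u x), mul_assoc, Finset.sum_mul]
  refine Finset.sum_congr rfl fun j _ => ?_
  ring

/-- A Gram matrix with positive weights of linearly independent functions is invertible. -/
theorem isUnit_weightedGram {X ι : Type*} [Fintype X] [Fintype ι] [DecidableEq ι]
    {D : ι → X → ℝ} (hli : LinearIndependent ℝ D) {u : X → ℝ} (hu : ∀ x, 0 < u x)
    {G : Matrix ι ι ℝ} (hG : ∀ i j, G i j = ∑ x, u x * D i x * D j x) : IsUnit G := by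
  rw [← Matrix.mulVec_injective_iff_isUnit]
  refine (injective_iff_map_eq_zero G.mulVecLin).2 fun v hv => ?_
  have h0 := dotProduct_weightedGram_mulVec hG v
  rw [Matrix.mulVecLin_apply] at hv
  rw [hv, dotProduct_zero, eq_comm,
    Finset.sum_eq_zero_iff_of_nonneg fun x _ => mul_nonneg (hu x).le (sq_nonneg _)] at h0
  refine funext (Fintype.linearIndependent_iff.1 hli v (funext fun x => ?_))
  simpa [(hu x).ne'] using h0 x (Finset.mem_univ x)


/-- For a C¹ family `θ ↦ p_θ` of strictly positive probability
distributions on a finite set `X` with `|X| = k+1`, whose partial derivatives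
`∂p_θ/∂θ_i` are linearly independent at `θ` (so the α-Fisher information matrix
`G^{(α)}(θ)` is invertible), and any `A : X → ℝ` with `E(θ) = ∑ x, A(x) p_θ(x)`:
`V_α[A] = (1/∑ y, p_θ(y)^{1-α}) ∑_{i,j} (G^{(α)}(θ)⁻¹)_{ij} ∂_i E ∂_j E`,
where `V_α` is the variance under the escort distribution of `p_θ`. -/
theorem variance_eq_norm_of_differential
    {X : Type*} [Fintype X] [Nonempty X] {k : ℕ}
    (hcard : Fintype.card X = k + 1)
    (Θ : Set (Fin k → ℝ)) (hΘ : IsOpen Θ)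
    (p : (Fin k → ℝ) → X → ℝ)
    (hpos : ∀ θ ∈ Θ, ∀ x, 0 < p θ x)
    (hsum : ∀ θ ∈ Θ, ∑ x, p θ x = 1)
    (hdiff : ∀ x, ContDiffOn ℝ 1 (fun θ => p θ x) Θ)
    (α : ℝ) (hα : 0 < α)
    (θ : Fin k → ℝ) (hθ : θ ∈ Θ)
    (hli : LinearIndependent ℝ
      (fun i : Fin k => fun x : X => fderiv ℝ (fun t => p t x) θ (Pi.single i 1)))
    (G : Matrix (Fin k) (Fin k) ℝ)
    (hG : ∀ i j, G i j = ∑ x, p θ x ^ (α - 1)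
        * fderiv ℝ (fun t => p t x) θ (Pi.single i 1)
        * fderiv ℝ (fun t => p t x) θ (Pi.single j 1))
    (A : X → ℝ)
    (E : (Fin k → ℝ) → ℝ) (hE : ∀ t, E t = ∑ x, A x * p t x)
    (S : ℝ) (hS : S = ∑ y, p θ y ^ (1 - α))
    (Eα : ℝ) (hEα : Eα = ∑ x, (p θ x ^ (1 - α) / S) * A x)
    (Vα : ℝ) (hVα : Vα = ∑ x, (p θ x ^ (1 - α) / S) * (A x - Eα) ^ 2) :
    Vα = (1 / S) * ∑ i, ∑ j, G⁻¹ i j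
        * fderiv ℝ E θ (Pi.single i 1) * fderiv ℝ E θ (Pi.single j 1) := by
  set D : Fin k → X → ℝ := fun i x => fderiv ℝ (fun t => p t x) θ (Pi.single i 1) with hDdef
  have hnhds : Θ ∈ nhds θ := hΘ.mem_nhds hθ
  have hd (x : X) : DifferentiableAt ℝ (fun t => p t x) θ :=
    ((hdiff x).contDiffAt hnhds).differentiableAt one_ne_zero
  have hDsum (i : Fin k) : ∑ x, D i x = 0 := by
    have hconst : (fun t => ∑ x, p t x) =ᶠ[nhds θ] fun _ => 1 :=
      Filter.eventually_of_mem hnhds hsum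
    have h := hconst.fderiv_eq (𝕜 := ℝ)
    rw [fderiv_fun_sum fun x _ => hd x] at h
    simpa using congrArg (fun L : (Fin k → ℝ) →L[ℝ] ℝ => L (Pi.single i 1)) h
  have hDE (i : Fin k) : fderiv ℝ E θ (Pi.single i 1) = ∑ x, A x * D i x := by
    rw [funext hE, fderiv_fun_sum fun x _ => (hd x).const_mul (A x)]
    simp [fderiv_const_mul, hd, hDdef]
  have hp := hpos θ hθ
  have hw (x : X) : 0 < p θ x ^ (1 - α) := Real.rpow_pos_of_pos (hp x) _
  have hu (x : X) : 0 < p θ x ^ (α - 1) := Real.rpow_pos_of_pos (hp x) _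
  have huw (x : X) : p θ x ^ (α - 1) * p θ x ^ (1 - α) = 1 := by
    rw [← Real.rpow_add (hp x)]
    simp
  have hSpos : 0 < S := hS ▸ Finset.sum_pos (fun x _ => hw x) Finset.univ_nonempty
  have hBsum : ∑ x, p θ x ^ (1 - α) * (A x - Eα) = 0 := by
    have hSE : S * Eα = ∑ x, p θ x ^ (1 - α) * A x := by
      rw [hEα, Finset.mul_sum]
      refine Finset.sum_congr rfl fun x _ => ?_
      field_simp
    simp only [mul_sub, Finset.sum_sub_distrib, ← Finset.sum_mul, ← hS, hSE, sub_self]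
  obtain ⟨c, hc⟩ := (Submodule.mem_span_range_iff_exists_fun ℝ).1
    (mem_span_range_of_sum_eq_zero hcard hli hDsum hBsum)
  have hcx (x : X) : ∑ j, c j * D j x = p θ x ^ (1 - α) * (A x - Eα) := by
    simpa using congrFun hc x
  have hGc : G.mulVec c = fun i => fderiv ℝ E θ (Pi.single i 1) := by
    ext i
    rw [weightedGram_mulVec hG, hDE]
    calc ∑ x, p θ x ^ (α - 1) * D i x * ∑ j, c j * D j x
        = ∑ x, (A x * D i x - Eα * D i x) := Finset.sum_congr rfl fun x _ => by
          rw [hcx]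
          linear_combination D i x * (A x - Eα) * huw x
      _ = ∑ x, A x * D i x := by
          rw [Finset.sum_sub_distrib, ← Finset.mul_sum, hDsum, mul_zero, sub_zero]
  have hinv : G⁻¹.mulVec (fun i => fderiv ℝ E θ (Pi.single i 1)) = c := by
    rw [← hGc, Matrix.mulVec_mulVec,
      Matrix.nonsing_inv_mul _ ((Matrix.isUnit_iff_isUnit_det _).1 (isUnit_weightedGram hli hu hG)),
      Matrix.one_mulVec]
  have hquad : ∑ i, ∑ j, G⁻¹ i j * fderiv ℝ E θ (Pi.single i 1) * fderiv ℝ E θ (Pi.single j 1)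
      = c ⬝ᵥ G.mulVec c := by
    rw [hGc]
    nth_rewrite 1 [← hinv]
    simp only [Matrix.mulVec, dotProduct, Finset.sum_mul]
    refine Finset.sum_congr rfl fun i _ => Finset.sum_congr rfl fun j _ => ?_
    ring
  rw [hquad, dotProduct_weightedGram_mulVec hG, hVα, Finset.mul_sum]
  refine Finset.sum_congr rfl fun x _ => ?_
  rw [hcx]
  linear_combination (-(p θ x ^ (1 - α) * (A x - Eα) ^ 2 / S)) * huw x
end

section
/- Generalized Cramér–Rao bound: Let 𝒳 be a nonempty finite set, Θ ⊆ ℝ^k open, θ ↦ p_θ a continuously differentiable family of strictly positive probability distributions on 𝒳, and n ≥ 1. For x = (x_1,…,x_n) ∈ 𝒳^n set p_θ^n(x) = ∏_{i=1}^n p_θ(x_i). Fix α > 0 and θ ∈ Θ, and assume the k×k matrix G_n^{(α)}(θ) with entries ∑_{x∈𝒳^n} p_θ^n(x)^{α−1} (∂p_θ^n(x)/∂θ_i)(∂p_θ^n(x)/∂θ_j) is invertible and that the vectors ∂p_θ^n/∂θ_1,…,∂p_θ^n/∂θ_k are linearly independent. Let θ̂ : 𝒳^n → ℝ^k be an unbiased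 estimator, i.e. ∑_{x∈𝒳^n} p_{θ'}^n(x) θ̂(x) = θ' for all θ' ∈ Θ. Let V_{α,θ}[θ̂] be the k×k covariance matrix of θ̂ under the escort distribution p_{α,θ}(x) = p_θ^n(x)^{1−α}/∑_{y∈𝒳^n} p_θ^n(y)^{1−α}. Then the matrix V_{α,θ}[θ̂] − (1/∑_{y∈𝒳^n} p_θ^n(y)^{1−α}) · [G_n^{(α)}(θ)]^{−1} is positive semidefinite. -/
open Matrix in
/-- Abstract matrix form of the Cramér–Rao inequality: the weighted Gram matrix of `T` dominates
`c • G⁻¹` when the weighted Gram matrix of `B` is `c • G` and the cross term is `c • 1`. -/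
theorem posSemidef_gram_sub_smul_inv {ι κ : Type*} [Fintype ι] [Fintype κ] [DecidableEq ι]
    [DecidableEq κ] (w : ι → ℝ) (hw : ∀ x, 0 ≤ w x) (T B : Matrix ι κ ℝ) (c : ℝ)
    (V G : Matrix κ κ ℝ) (hG : IsUnit G.det) (hGsymm : Gᵀ = G)
    (hV : Tᵀ * diagonal w * T = V) (hB : Bᵀ * diagonal w * B = c • G)
    (hTB : Tᵀ * diagonal w * B = c • (1 : Matrix κ κ ℝ)) :
    (V - c • G⁻¹).PosSemidef := by
  have hBT : Bᵀ * diagonal w * T = c • (1 : Matrix κ κ ℝ) := by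
    have h := congrArg transpose hTB
    simpa [Matrix.mul_assoc] using h
  have hsymm : (G⁻¹)ᵀ = G⁻¹ := by rw [transpose_nonsing_inv, hGsymm]
  have key : (T - B * G⁻¹)ᵀ * diagonal w * (T - B * G⁻¹) = V - c • G⁻¹ := by
    calc (T - B * G⁻¹)ᵀ * diagonal w * (T - B * G⁻¹)
        = Tᵀ * diagonal w * T - (Tᵀ * diagonal w * B) * G⁻¹
          - G⁻¹ * (Bᵀ * diagonal w * T) + G⁻¹ * (Bᵀ * diagonal w * B) * G⁻¹ := by
          rw [transpose_sub, transpose_mul, hsymm]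
          simp only [Matrix.sub_mul, Matrix.mul_sub, Matrix.mul_assoc]
          abel
      _ = V - c • G⁻¹ := by
          rw [hV, hB, hTB, hBT]
          simp [nonsing_inv_mul G hG]
  rw [← key]
  simpa using (PosSemidef.diagonal hw).conjTranspose_mul_mul_same (T - B * G⁻¹)

/-- Differentiating a finite sum `∑ x, f t x * a x` that agrees with `g` near `θ`. -/
theorem sum_fderiv_apply_mul_eq {E ι : Type*} [NormedAddCommGroup E] [NormedSpace ℝ E]
    [Fintype ι] {f : E → ι → ℝ} {θ : E} (hf : ∀ x, DifferentiableAt ℝ (fun t => f t x) θ)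
    (a : ι → ℝ) {g : E → ℝ} {g' : E →L[ℝ] ℝ} (hg : HasFDerivAt g g' θ)
    (h : ∀ᶠ t in nhds θ, ∑ x, f t x * a x = g t) (v : E) :
    ∑ x, fderiv ℝ (fun t => f t x) θ v * a x = g' v := by
  have h₁ : HasFDerivAt (fun t => ∑ x, f t x * a x)
      (∑ x, a x • fderiv ℝ (fun t => f t x) θ) θ :=
    HasFDerivAt.fun_sum fun x _ => (hf x).hasFDerivAt.mul_const (a x)
  have h₂ := h₁.unique (hg.congr_of_eventuallyEq h)
  rw [← h₂]
  simp [mul_comm]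

/-- Generalized Cramér–Rao bound: Let `θ ↦ p_θ` be a C¹ family of
strictly positive probability distributions on a finite set `X`, `n ≥ 1`,
`p_θⁿ(x) = ∏ i, p_θ(x_i)` on `Xⁿ`, `α > 0`, `θ ∈ Θ`. Assume the α-Fisher
information matrix `G_n^{(α)}(θ)` is invertible and the partial derivatives
`∂p_θⁿ/∂θ_i` are linearly independent. If `θ̂ : Xⁿ → ℝᵏ` is unbiased, then
`V_{α,θ}[θ̂] - (1/∑ y, p_θⁿ(y)^{1-α}) [G_n^{(α)}(θ)]⁻¹` is positive
semidefinite, where `V_{α,θ}[θ̂]` is the covariance matrix of `θ̂` under the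
escort distribution of `p_θⁿ`. -/
theorem generalized_cramer_rao_bound
    {X : Type*} [Fintype X] [Nonempty X] {k n : ℕ} (hn : 1 ≤ n)
    (Θ : Set (Fin k → ℝ)) (hΘ : IsOpen Θ)
    (p : (Fin k → ℝ) → X → ℝ)
    (hpos : ∀ θ ∈ Θ, ∀ x, 0 < p θ x)
    (hsum : ∀ θ ∈ Θ, ∑ x, p θ x = 1)
    (hdiff : ∀ x, ContDiffOn ℝ 1 (fun θ => p θ x) Θ)
    (α : ℝ) (hα : 0 < α)
    (θ : Fin k → ℝ) (hθ : θ ∈ Θ)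
    (pn : (Fin k → ℝ) → (Fin n → X) → ℝ)
    (hpn : ∀ t x, pn t x = ∏ i, p t (x i))
    (G : Matrix (Fin k) (Fin k) ℝ)
    (hG : ∀ i j, G i j = ∑ x : Fin n → X, pn θ x ^ (α - 1)
        * fderiv ℝ (fun t => pn t x) θ (Pi.single i 1)
        * fderiv ℝ (fun t => pn t x) θ (Pi.single j 1))
    (hGinv : IsUnit G.det)
    (hli : LinearIndependent ℝ (fun i : Fin k => fun x : Fin n → X =>
        fderiv ℝ (fun t => pn t x) θ (Pi.single i 1)))
    (θhat : (Fin n → X) → Fin k → ℝ)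
    (hunbiased : ∀ t ∈ Θ, ∀ i, ∑ x : Fin n → X, pn t x * θhat x i = t i)
    (S : ℝ) (hS : S = ∑ y : Fin n → X, pn θ y ^ (1 - α))
    (V : Matrix (Fin k) (Fin k) ℝ)
    (hV : ∀ i j, V i j = ∑ x : Fin n → X, (pn θ x ^ (1 - α) / S)
        * (θhat x i - ∑ y : Fin n → X, (pn θ y ^ (1 - α) / S) * θhat y i)
        * (θhat x j - ∑ y : Fin n → X, (pn θ y ^ (1 - α) / S) * θhat y j)) :
    (V - (1 / S) • G⁻¹).PosSemidef := by
  classical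
  have hΘθ : ∀ᶠ t in nhds θ, t ∈ Θ := hΘ.mem_nhds hθ
  have hpn_pos : ∀ x, 0 < pn θ x := fun x => by
    rw [hpn]
    exact Finset.prod_pos fun i _ => hpos θ hθ (x i)
  have hpn_diff : ∀ x, DifferentiableAt ℝ (fun t => pn t x) θ := fun x => by
    have hp : ∀ y, DifferentiableAt ℝ (fun t => p t y) θ := fun y =>
      ((hdiff y).contDiffAt (hΘ.mem_nhds hθ)).differentiableAt one_ne_zero
    simp only [hpn]
    fun_prop
  have hpn_sum : ∀ t ∈ Θ, ∑ x, pn t x = 1 := fun t ht => by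
    simp only [hpn]
    rw [← Fintype.piFinset_univ, ← Finset.prod_univ_sum (fun _ => Finset.univ) fun _ => p t]
    simp [hsum t ht]
  have hS_pos : 0 < S := by
    rw [hS]
    exact Finset.sum_pos (fun x _ => Real.rpow_pos_of_pos (hpn_pos x) _) Finset.univ_nonempty
  set D : Fin k → (Fin n → X) → ℝ := fun i x =>
    fderiv ℝ (fun t => pn t x) θ (Pi.single i 1)
  have hD_sum : ∀ i, ∑ x, D i x = 0 := fun i => by
    simpa using sum_fderiv_apply_mul_eq hpn_diff (fun _ => 1) (hasFDerivAt_const (1 : ℝ) θ)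
      (hΘθ.mono fun t ht => by simpa using hpn_sum t ht) (Pi.single i 1)
  have hD_unbiased : ∀ i j, ∑ x, D j x * θhat x i = (1 : Matrix (Fin k) (Fin k) ℝ) i j :=
    fun i j => by
      have h := sum_fderiv_apply_mul_eq hpn_diff (fun x => θhat x i) (hasFDerivAt_apply i θ)
        (hΘθ.mono fun t ht => hunbiased t ht i) (Pi.single j 1)
      simpa [Matrix.one_apply, Pi.single_apply] using h
  have hpow : ∀ x, pn θ x ^ (1 - α) * pn θ x ^ (α - 1) = 1 := fun x => by
    rw [← Real.rpow_add (hpn_pos x)]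
    simp
  set m : Fin k → ℝ := fun i => ∑ y, pn θ y ^ (1 - α) / S * θhat y i
  refine posSemidef_gram_sub_smul_inv (fun x => pn θ x ^ (1 - α) / S)
    (fun x => div_nonneg (Real.rpow_nonneg (hpn_pos x).le _) hS_pos.le)
    (Matrix.of fun x i => θhat x i - m i) (Matrix.of fun x j => pn θ x ^ (α - 1) * D j x)
    (1 / S) V G hGinv ?_ ?_ ?_ ?_
  · ext i j
    rw [Matrix.transpose_apply, hG, hG]
    exact Finset.sum_congr rfl fun x _ => by ring
  · ext i j
    rw [hV, Matrix.mul_apply]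
    refine Finset.sum_congr rfl fun x _ => ?_
    rw [Matrix.mul_diagonal, Matrix.transpose_apply, Matrix.of_apply, Matrix.of_apply]
    ring
  · ext i j
    rw [Matrix.mul_apply, Matrix.smul_apply, hG, smul_eq_mul, Finset.mul_sum]
    refine Finset.sum_congr rfl fun x _ => ?_
    rw [Matrix.mul_diagonal, Matrix.transpose_apply, Matrix.of_apply, Matrix.of_apply]
    linear_combination (1 / S * pn θ x ^ (α - 1) * D i x * D j x) * hpow x
  · ext i j
    rw [Matrix.mul_apply, Matrix.smul_apply, smul_eq_mul, ← hD_unbiased]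
    calc _ = ∑ x, (1 / S * (D j x * θhat x i) - 1 / S * m i * D j x) := by
          refine Finset.sum_congr rfl fun x _ => ?_
          rw [Matrix.mul_diagonal, Matrix.transpose_apply, Matrix.of_apply, Matrix.of_apply]
          linear_combination (1 / S * (θhat x i - m i) * D j x) * hpow x
      _ = _ := by
          rw [Finset.sum_sub_distrib, ← Finset.mul_sum, ← Finset.mul_sum, hD_sum]
          ring
end

section
/- Eguchi-type derivation of the α-Fisher metric from the BHHJ divergence: Let 𝒳 be a nonempty finite set, Θ ⊆ ℝ^k open, θ ↦ p_θ a twice continuously differentiable family of strictly positive probability distributions on 𝒳, and α > 0. Then for every θ ∈ Θ and all i, j ∈ {1,…,k}, − (∂/∂θ_i)(∂/∂θ'_j) B^{(α)}(p_θ, p_{θ'}) evaluated at θ' = θ equals ∑_{x∈𝒳} p_θ(x)^{α−1} (∂p_θ(x)/∂θ_i)(∂p_θ(x)/∂θ_j), where the ∂/∂θ_i derivative acts on the first argument and ∂/∂θ'_j on the second. -/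
/-- Differential of one summand of the BHHJ divergence in its second argument, the value `q` of
the first argument being held fixed. -/
theorem HasFDerivAt.bhhj_summand {E : Type*} [NormedAddCommGroup E] [NormedSpace ℝ E]
    {f : E → ℝ} {f' : E →L[ℝ] ℝ} {a : E} (hf : HasFDerivAt f f' a) (ha : 0 < f a)
    {α : ℝ} (hα : 0 < α) (q : ℝ) :
    HasFDerivAt
      (fun t => f t ^ (1 + α) / (1 + α) - q * f t ^ α / α + q ^ (1 + α) / (α * (1 + α)))
      ((f a ^ α - q * f a ^ (α - 1)) • f') a := by
  have h1 := (hf.rpow_const (p := 1 + α) (Or.inl ha.ne')).mul_const (1 + α)⁻¹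
  have h2 := ((hf.rpow_const (p := α) (Or.inl ha.ne')).const_mul q).mul_const α⁻¹
  simp only [div_eq_mul_inv]
  refine ((h1.sub h2).add_const _).congr_fderiv ?_
  ext v
  have hα' : 1 + α ≠ 0 := by positivity
  simp only [add_sub_cancel_left, sub_apply, smul_apply,
    smul_eq_mul]
  field_simp

/-- Eguchi-type derivation of the α-Fisher metric from the BHHJ
divergence: For a C² family `θ ↦ p_θ` of strictly positive probability
distributions on a finite set `X` and `α > 0`, for every `θ ∈ Θ` and `i, j`,
`-(∂/∂θ_i)(∂/∂θ'_j) B^{(α)}(p_θ, p_{θ'})` evaluated at `θ' = θ` equals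
`∑ x, p_θ(x)^{α-1} (∂p_θ(x)/∂θ_i)(∂p_θ(x)/∂θ_j)`, where
`B^{(α)}(q,p) = ∑ x, [p(x)^{1+α}/(1+α) - q(x)p(x)^α/α + q(x)^{1+α}/(α(1+α))]`. -/
theorem eguchi_alpha_fisher_from_bhhj
    {X : Type*} [Fintype X] [Nonempty X] {k : ℕ}
    (Θ : Set (Fin k → ℝ)) (hΘ : IsOpen Θ)
    (p : (Fin k → ℝ) → X → ℝ)
    (hpos : ∀ θ ∈ Θ, ∀ x, 0 < p θ x)
    (hsum : ∀ θ ∈ Θ, ∑ x, p θ x = 1)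
    (hdiff : ∀ x, ContDiffOn ℝ 2 (fun θ => p θ x) Θ)
    (α : ℝ) (hα : 0 < α)
    (B : (Fin k → ℝ) → (Fin k → ℝ) → ℝ)
    (hB : ∀ s t, B s t = ∑ x, (p t x ^ (1 + α) / (1 + α)
        - p s x * p t x ^ α / α + p s x ^ (1 + α) / (α * (1 + α))))
    (θ : Fin k → ℝ) (hθ : θ ∈ Θ) (i j : Fin k) :
    -(fderiv ℝ (fun s => fderiv ℝ (fun t => B s t) θ (Pi.single j 1)) θ
        (Pi.single i 1))
      = ∑ x, p θ x ^ (α - 1)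
          * fderiv ℝ (fun t => p t x) θ (Pi.single i 1)
          * fderiv ℝ (fun t => p t x) θ (Pi.single j 1) := by
  have hp : ∀ x, HasFDerivAt (fun t => p t x) (fderiv ℝ (fun t => p t x) θ) θ := fun x =>
    (((hdiff x).contDiffAt (hΘ.mem_nhds hθ)).differentiableAt (by norm_num)).hasFDerivAt
  have inner_deriv : ∀ s, fderiv ℝ (fun t => B s t) θ (Pi.single j 1)
      = ∑ x, (p θ x ^ α - p s x * p θ x ^ (α - 1))
          * fderiv ℝ (fun t => p t x) θ (Pi.single j 1) := by
    intro s
    simp only [hB]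
    rw [(HasFDerivAt.fun_sum fun x _ =>
      (hp x).bhhj_summand (hpos θ hθ x) hα (p s x)).fderiv]
    simp
  simp only [inner_deriv]
  rw [(HasFDerivAt.fun_sum fun x _ => (((hp x).mul_const (p θ x ^ (α - 1))).const_sub
    (p θ x ^ α)).mul_const (fderiv ℝ (fun t => p t x) θ (Pi.single j 1))).fderiv]
  simp only [sum_apply, smul_apply,
    neg_apply, smul_eq_mul, ← Finset.sum_neg_distrib]
  exact Finset.sum_congr rfl fun x _ => by ring
end

section
/- Let 𝒳 be a nonempty finite set and q, p strictly positive probability distributions on 𝒳. Then B^{(α)}(q,p) → ∑_{x∈𝒳} q(x) log( q(x)/p(x) ) as α → 0 from the right; that is, the function α ↦ B^{(α)}(q,p) on (0,∞) tends to the Kullback–Leibler divergence I(q,p) along the filter of right-neighborhoods of 0. -/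
open Filter Topology in
theorem tendsto_bhhj_summand {a b : ℝ} (ha : 0 < a) (hb : 0 < b) :
    Tendsto (fun α : ℝ => b ^ (1 + α) / (1 + α) - a * b ^ α / α + a ^ (1 + α) / (α * (1 + α)))
      (𝓝[>] 0) (𝓝 (b - a + a * Real.log (a / b))) := by
  have hd : HasDerivAt (fun α : ℝ => a ^ α - b ^ α) (Real.log (a / b)) 0 := by
    rw [Real.log_div ha.ne' hb.ne']
    simpa using (Real.hasStrictDerivAt_const_rpow ha 0).hasDerivAt.fun_sub
      (Real.hasStrictDerivAt_const_rpow hb 0).hasDerivAt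
  have hslope := hd.tendsto_slope_zero_right
  have hc : Tendsto (fun α : ℝ => (b ^ (1 + α) - a ^ (1 + α)) / (1 + α)) (𝓝[>] 0) (𝓝 (b - a)) := by
    have h : ContinuousAt (fun α : ℝ => (b ^ (1 + α) - a ^ (1 + α)) / (1 + α)) 0 := by
      fun_prop (disch := simp [ha.ne', hb.ne'])
    simpa using h.tendsto.mono_left nhdsWithin_le_nhds
  refine (hc.add (hslope.const_mul a)).congr' ?_
  filter_upwards [self_mem_nhdsWithin] with α hα
  have hα : 0 < α := hα
  have hα' : 1 + α ≠ 0 := by positivity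
  simp only [zero_add, Real.rpow_zero, smul_eq_mul, sub_self, sub_zero, Real.rpow_add ha,
    Real.rpow_add hb, Real.rpow_one]
  field_simp
  ring

/-- For strictly positive probability distributions `q, p` on a
nonempty finite set `X`, the BHHJ divergence `B^{(α)}(q,p)` tends to the
Kullback–Leibler divergence `∑ x, q(x) log(q(x)/p(x))` as `α → 0⁺`. -/
theorem bhhj_tendsto_kl
    {X : Type*} [Fintype X] [Nonempty X]
    (q p : X → ℝ) (hq : ∀ x, 0 < q x) (hp : ∀ x, 0 < p x)
    (hq1 : ∑ x, q x = 1) (hp1 : ∑ x, p x = 1) :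
    Filter.Tendsto
      (fun α : ℝ => ∑ x, (p x ^ (1 + α) / (1 + α)
        - q x * p x ^ α / α + q x ^ (1 + α) / (α * (1 + α))))
      (nhdsWithin 0 (Set.Ioi 0))
      (nhds (∑ x, q x * Real.log (q x / p x))) := by
  have hsum : ∑ x, q x * Real.log (q x / p x) =
      ∑ x, (p x - q x + q x * Real.log (q x / p x)) := by
    rw [Finset.sum_add_distrib, Finset.sum_sub_distrib, hq1, hp1, sub_self, zero_add]
  rw [hsum]
  exact tendsto_finsetSum _ fun x _ => tendsto_bhhj_summand (hq x) (hp x)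
end

section
/- Let 𝒳 be a nonempty finite set, α > 0, x_1,…,x_n ∈ 𝒳 a sample with empirical distribution p̂(x) = |{i : x_i = x}|/n, and p a strictly positive probability distribution on 𝒳. Then B^{(α)}(p̂, p) = − l^{(α)}/(1+α) + ( ∑_{x∈𝒳} p̂(x)^{1+α} − 1 )/(α(1+α)), where l^{(α)} = (1/n)∑_{i=1}^n ((1+α) p(x_i)^α − 1)/α − ∑_{x∈𝒳} p(x)^{1+α} is the BHHJ likelihood. In particular, since the second summand does not depend on p, maximizing the BHHJ likelihood over p is equivalent to minimizing B^{(α)}(p̂, p) over p. -/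
/-- The sample mean of `f` is its expectation under the empirical distribution. -/
theorem sum_card_fiber_div_mul_eq_sample_mean {ι X : Type*} [Fintype ι] [Fintype X]
    [DecidableEq X] (xs : ι → X) (f : X → ℝ) (c : ℝ) :
    ∑ x, ((Finset.univ.filter fun i => xs i = x).card : ℝ) / c * f x
      = (1 / c) * ∑ i, f (xs i) := by
  rw [← Finset.sum_fiberwise Finset.univ xs fun i => f (xs i), Finset.mul_sum]
  refine Finset.sum_congr rfl fun x _ => ?_
  have h : ∑ i with xs i = x, f (xs i) = ∑ i with xs i = x, f x :=
    Finset.sum_congr rfl fun i hi => by rw [(Finset.mem_filter.mp hi).2]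
  rw [h, Finset.sum_const, nsmul_eq_mul]
  ring

/-- For `α > 0`, a sample `x_1, …, x_n` with empirical
distribution `p̂(x) = |{i : x_i = x}|/n`, and a strictly positive probability
distribution `p`, one has
`B^{(α)}(p̂, p) = - l^{(α)}/(1+α) + (∑ x, p̂(x)^{1+α} − 1)/(α(1+α))`, where
`l^{(α)} = (1/n)∑ i, ((1+α) p(x_i)^α − 1)/α − ∑ x, p(x)^{1+α}` is the BHHJ
likelihood. (Since the second summand does not depend on `p`, maximizing the
BHHJ likelihood is equivalent to minimizing `B^{(α)}(p̂, p)`.) -/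
theorem bhhj_divergence_eq_neg_likelihood
    {X : Type*} [Fintype X] [Nonempty X] [DecidableEq X]
    (α : ℝ) (hα : 0 < α)
    {n : ℕ} (hn : 1 ≤ n) (xs : Fin n → X)
    (phat : X → ℝ)
    (hphat : ∀ y, phat y = ((Finset.univ.filter fun i => xs i = y).card : ℝ) / n)
    (p : X → ℝ) (hp : ∀ x, 0 < p x) (hp1 : ∑ x, p x = 1)
    (l : ℝ)
    (hl : l = (1 / (n : ℝ)) * ∑ i, ((1 + α) * p (xs i) ^ α - 1) / α
        - ∑ x, p x ^ (1 + α)) :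
    ∑ x, (p x ^ (1 + α) / (1 + α) - phat x * p x ^ α / α
        + phat x ^ (1 + α) / (α * (1 + α)))
      = -l / (1 + α) + ((∑ x, phat x ^ (1 + α)) - 1) / (α * (1 + α)) := by
  have hn0 : (n : ℝ) ≠ 0 := by positivity
  have hα1 : 1 + α ≠ 0 := by positivity
  have h_mean : ∑ x, phat x * p x ^ α = (1 / (n : ℝ)) * ∑ i, p (xs i) ^ α := by
    simp only [hphat]
    exact sum_card_fiber_div_mul_eq_sample_mean xs (fun x => p x ^ α) n
  rw [hl, Finset.sum_add_distrib, Finset.sum_sub_distrib, ← Finset.sum_div, ← Finset.sum_div,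
    ← Finset.sum_div, ← Finset.sum_div, Finset.sum_sub_distrib, ← Finset.mul_sum, h_mean]
  simp only [Finset.sum_const, Finset.card_univ, Fintype.card_fin, nsmul_eq_mul, mul_one]
  field_simp
  ring
end

section
/- Divergence property of the BHHJ divergence: Let 𝒳 be a nonempty finite set, α > 0, and q, p strictly positive probability distributions on 𝒳. Then B^{(α)}(q,p) ≥ 0, and B^{(α)}(q,p) = 0 if and only if q = p. -/
/-- The summand of the BHHJ divergence vanishes on the diagonal. -/
theorem bhhj_term_self {α a : ℝ} (hα : 0 < α) (ha : 0 < a) :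
    a ^ (1 + α) / (1 + α) - a * a ^ α / α + a ^ (1 + α) / (α * (1 + α)) = 0 := by
  have h1α : 1 + α ≠ 0 := by positivity
  rw [Real.rpow_add ha, Real.rpow_one]
  field_simp
  ring

/-- The summand of the BHHJ divergence is positive off the diagonal. -/
theorem bhhj_term_pos {α a b : ℝ} (hα : 0 < α) (ha : 0 < a) (hb : 0 < b) (hab : a ≠ b) :
    0 < b ^ (1 + α) / (1 + α) - a * b ^ α / α + a ^ (1 + α) / (α * (1 + α)) := by
  have hs : -1 ≤ a / b - 1 := by linarith [div_pos ha hb]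
  have hs' : a / b - 1 ≠ 0 := by rwa [sub_ne_zero, ne_eq, div_eq_one_iff_eq hb.ne']
  have bernoulli := one_add_mul_self_lt_rpow_one_add hs hs' (p := 1 + α) (by linarith)
  have hbα : b ^ (1 + α) = b * b ^ α := by rw [Real.rpow_add hb, Real.rpow_one]
  rw [add_sub_cancel, Real.div_rpow ha.le hb.le, lt_div_iff₀ (by positivity), hbα] at bernoulli
  have hlhs : (1 + (1 + α) * (a / b - 1)) * (b * b ^ α)
      = (1 + α) * (a * b ^ α) - α * (b * b ^ α) := by
    field_simp
    ring
  have hterm : b ^ (1 + α) / (1 + α) - a * b ^ α / α + a ^ (1 + α) / (α * (1 + α))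
      = (a ^ (1 + α) - ((1 + α) * (a * b ^ α) - α * (b * b ^ α))) / (α * (1 + α)) := by
    rw [hbα]
    field_simp
    ring
  rw [hterm]
  exact div_pos (by linarith) (by positivity)

/-- The summand of the BHHJ divergence is nonnegative. -/
theorem bhhj_term_nonneg {α a b : ℝ} (hα : 0 < α) (ha : 0 < a) (hb : 0 < b) :
    0 ≤ b ^ (1 + α) / (1 + α) - a * b ^ α / α + a ^ (1 + α) / (α * (1 + α)) := by
  rcases eq_or_ne a b with rfl | hab
  · exact (bhhj_term_self hα ha).ge
  · exact (bhhj_term_pos hα ha hb hab).le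

/-- Divergence property of the BHHJ divergence: For `α > 0` and
strictly positive probability distributions `q, p` on a nonempty finite set
`X`, `B^{(α)}(q,p) ≥ 0`, with equality iff `q = p`. -/
theorem bhhj_divergence_nonneg_and_eq_zero_iff
    {X : Type*} [Fintype X] [Nonempty X]
    (α : ℝ) (hα : 0 < α)
    (q p : X → ℝ) (hq : ∀ x, 0 < q x) (hp : ∀ x, 0 < p x)
    (hq1 : ∑ x, q x = 1) (hp1 : ∑ x, p x = 1) :
    0 ≤ ∑ x, (p x ^ (1 + α) / (1 + α) - q x * p x ^ α / α
          + q x ^ (1 + α) / (α * (1 + α)))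
    ∧ ((∑ x, (p x ^ (1 + α) / (1 + α) - q x * p x ^ α / α
          + q x ^ (1 + α) / (α * (1 + α)))) = 0 ↔ q = p) := by
  have hnonneg x := bhhj_term_nonneg hα (hq x) (hp x)
  refine ⟨Finset.sum_nonneg fun x _ => hnonneg x, fun h => ?_, ?_⟩
  · rw [Finset.sum_eq_zero_iff_of_nonneg fun x _ => hnonneg x] at h
    funext x
    by_contra hx
    exact (bhhj_term_pos hα (hq x) (hp x) hx).ne' (h x (Finset.mem_univ x))
  · rintro rfl
    exact Finset.sum_eq_zero fun x _ => bhhj_term_self hα (hq x)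
end
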